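/- (Energy–Score identity.) Let λ, β > 0 with β ∈ (0,2], Σ a symmetric positive definite n×n matrix, q(u) = Z⁻¹ exp(−(λ/β)‖u‖_{Σ⁻¹}^β) the generalized Gaussian density, p a probability density on ℝⁿ, and m(y) = ∫ p(x) q(y−x) dx. Fix y with m(y) > 0 and let P_y denote the posterior probability measure with density x ↦ p(x) q(y−x)/m(y). Assume differentiation under the integral sign is valid at y, E_{X∼P_y}[‖X−y‖_{Σ⁻¹}^{β−1}] < ∞, and P_y({y}) = 0 when β < 2. Then the Stein score of the noisy marginal equals −(λ/β) times the gradient at y′ = y of the Mahalanobis energy score evaluated at the fixed posterior: ∇ log m(y) = −(λ/β) · ∇_{y′} ES_{Σ⁻¹,β}(P_y, y′)|_{y′=y}. -/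

import Mathlib

open MeasureTheory Matrix

noncomputable section

/-- Mahalanobis norm `‖u‖_{S} = √(uᵀ S u)` (applied with `S = Σ⁻¹`). -/
def mahNorm {n : ℕ} (S : Matrix (Fin n) (Fin n) ℝ) (u : EuclideanSpace ℝ (Fin n)) : ℝ :=
  Real.sqrt ((u : Fin n → ℝ) ⬝ᵥ S.mulVec u)

/-- The (negative) Mahalanobis energy score
`ES_{S,β}(P,y) = E_{X∼P}[‖X-y‖_S^β] - ½ E_{X,X'∼P}[‖X-X'‖_S^β]`. -/
def ES {n : ℕ} (S : Matrix (Fin n) (Fin n) ℝ) (β : ℝ)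
    (P : Measure (EuclideanSpace ℝ (Fin n))) (y : EuclideanSpace ℝ (Fin n)) : ℝ :=
  (∫ x, mahNorm S (x - y) ^ β ∂P) - (1 / 2) * ∫ x, ∫ x', mahNorm S (x - x') ^ β ∂P ∂P

lemma mahNorm_neg {n : ℕ} (S : Matrix (Fin n) (Fin n) ℝ) (u : EuclideanSpace ℝ (Fin n)) :
    mahNorm S (-u) = mahNorm S u := by
  simp [mahNorm, Matrix.mulVec_neg]

lemma continuous_mahNorm {n : ℕ} (S : Matrix (Fin n) (Fin n) ℝ) : Continuous (mahNorm S) := by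
  unfold mahNorm
  fun_prop

/-- The chain rule for `C * exp (-(c * f))`; it needs no differentiability of `f`, since `f` is
differentiable wherever `C * exp (-(c * f))` is. -/
lemma gradient_const_mul_exp_neg {E : Type*} [NormedAddCommGroup E] [InnerProductSpace ℝ E]
    [CompleteSpace E] {f : E → ℝ} {C c : ℝ} (hC : C ≠ 0) (hc : c ≠ 0) (u : E) :
    gradient (fun v => C * Real.exp (-(c * f v))) u
      = (-c * (C * Real.exp (-(c * f u)))) • gradient f u := by
  by_cases hf : DifferentiableAt ℝ f u
  · have h : fderiv ℝ (fun v => C * Real.exp (-(c * f v))) u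
        = C • Real.exp (-(c * f u)) • -(c • fderiv ℝ f u) :=
      (((hf.hasFDerivAt.const_mul c).neg).exp.const_mul C).fderiv
    simp only [gradient, h, ← map_smul]
    congr 1
    ext v
    simp
    ring
  · have hg : ¬ DifferentiableAt ℝ (fun v => C * Real.exp (-(c * f v))) u := by
      intro h
      apply hf
      have h2 : DifferentiableAt ℝ
          (fun v => -c⁻¹ * Real.log (C⁻¹ * (C * Real.exp (-(c * f v))))) u :=
        ((h.const_mul C⁻¹).log (by simp [hC])).const_mul _
      convert h2 using 2 with v
      rw [inv_mul_cancel_left₀ hC, Real.log_exp]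
      field_simp
    simp [gradient, fderiv_zero_of_not_differentiableAt hf,
      fderiv_zero_of_not_differentiableAt hg]

lemma gradient_comp_sub_const {E : Type*} [NormedAddCommGroup E] [InnerProductSpace ℝ E]
    [CompleteSpace E] (f : E → ℝ) (x y : E) :
    gradient (fun z => f (z - x)) y = gradient f (y - x) := by
  simp [gradient, fderiv_comp_sub]

/-- **The Energy–Score identity.** For generalized Gaussian noise
`q(u) = Z⁻¹ exp(-(λ/β)‖u‖_{Σ⁻¹}^β)` with `β ∈ (0,2]`, clean density `p`, noisy marginal
`m(y) = ∫ p(x) q(y-x) dx` positive at `y`, and posterior measure `P_y` with density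
`x ↦ p(x) q(y-x)/m(y)`, assuming differentiation under the integral sign at `y`,
`E_{P_y}[‖X-y‖_{Σ⁻¹}^{β-1}] < ∞`, and `P_y({y}) = 0` when `β < 2`, the Stein score of the
noisy marginal equals `-(λ/β)` times the (path) gradient at `y' = y` of the Mahalanobis
energy score evaluated at the fixed posterior. -/
theorem energy_score_identity
    {n : ℕ} (lam β : ℝ) (hlam : 0 < lam) (hβ : 0 < β) (hβ2 : β ≤ 2)
    (Sig : Matrix (Fin n) (Fin n) ℝ) (hSig : Sig.PosDef)
    (Z : ℝ) (hZ : 0 < Z)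
    (q : EuclideanSpace ℝ (Fin n) → ℝ)
    (hq : ∀ u, q u = Z⁻¹ * Real.exp (-(lam / β * mahNorm Sig⁻¹ u ^ β)))
    (hq_int : ∫ u, q u = 1)
    (p : EuclideanSpace ℝ (Fin n) → ℝ)
    (hp_nonneg : ∀ x, 0 ≤ p x) (hp_int : ∫ x, p x = 1)
    (m : EuclideanSpace ℝ (Fin n) → ℝ)
    (hm : ∀ z, m z = ∫ x, p x * q (z - x))
    (y : EuclideanSpace ℝ (Fin n)) (hmy : 0 < m y)
    (Py : Measure (EuclideanSpace ℝ (Fin n)))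
    (hPy : Py = volume.withDensity fun x => ENNReal.ofReal (p x * q (y - x) / m y))
    (hDUI : HasGradientAt m (∫ x, p x • gradient q (y - x)) y)
    (hDUI_ES : HasGradientAt (fun y' => ∫ x, mahNorm Sig⁻¹ (x - y') ^ β ∂Py)
        (∫ x, gradient (fun y' => mahNorm Sig⁻¹ (x - y') ^ β) y ∂Py) y)
    (hmom : Integrable (fun x => mahNorm Sig⁻¹ (x - y) ^ (β - 1)) Py)
    (hpt : β < 2 → Py {y} = 0) :
    gradient (fun z => Real.log (m z)) y
      = (-(lam / β)) • gradient (fun y' => ES Sig⁻¹ β Py y') y := by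
  have hlog : gradient (fun z => Real.log (m z)) y
      = (m y)⁻¹ • ∫ x, p x • gradient q (y - x) := by
    have h := (hDUI.hasFDerivAt.log hmy.ne').fderiv
    simp only [gradient] at h ⊢
    rw [h, map_smul, LinearIsometryEquiv.symm_apply_apply]
  have hES : gradient (fun y' => ES Sig⁻¹ β Py y') y
      = ∫ x, gradient (fun y' => mahNorm Sig⁻¹ (x - y') ^ β) y ∂Py := by
    have h := (hDUI_ES.hasFDerivAt.sub_const
      ((1 / 2) * ∫ x, ∫ x', mahNorm Sig⁻¹ (x - x') ^ β ∂Py ∂Py)).fderiv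
    simp only [gradient, ES] at h ⊢
    rw [h, LinearIsometryEquiv.symm_apply_apply]
  have hp : AEMeasurable p := by
    refine (Integrable.of_integral_ne_zero ?_).aemeasurable
    rw [hp_int]
    exact one_ne_zero
  have hq_meas : Measurable q := by
    have h : Continuous fun u => mahNorm Sig⁻¹ u ^ β :=
      (continuous_mahNorm _).rpow_const fun _ => Or.inr hβ.le
    rw [funext hq]
    exact (continuous_const.mul (continuous_const.mul h).neg.rexp).measurable
  have hq_nonneg : ∀ u, 0 ≤ q u := fun u => by
    rw [hq]
    positivity
  have hgrad_q : ∀ u, gradient q u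
      = (-(lam / β) * q u) • gradient (fun v => mahNorm Sig⁻¹ v ^ β) u := by
    intro u
    rw [hq u, funext hq]
    exact gradient_const_mul_exp_neg (inv_ne_zero hZ.ne') (div_pos hlam hβ).ne' u
  have hgrad_mah : ∀ x, gradient (fun y' => mahNorm Sig⁻¹ (x - y') ^ β) y
      = gradient (fun v => mahNorm Sig⁻¹ v ^ β) (y - x) := by
    intro x
    rw [← gradient_comp_sub_const]
    congr 1
    ext y'
    rw [← mahNorm_neg, neg_sub]
  have hdens : AEMeasurable fun x => ENNReal.ofReal (p x * q (y - x) / m y) :=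
    ((hp.mul (hq_meas.comp (measurable_const.sub measurable_id)).aemeasurable).div_const
      _).ennreal_ofReal
  rw [hlog, hES, hPy, integral_withDensity_eq_integral_toReal_smul₀ hdens (by simp),
    ← integral_smul, ← integral_smul]
  congr 1
  ext1 x
  rw [ENNReal.toReal_ofReal
    (div_nonneg (mul_nonneg (hp_nonneg x) (hq_nonneg _)) hmy.le), hgrad_q, hgrad_mah]
  simp only [smul_smul]
  congr 1
  ring
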